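/- (Lemma 15.) There is no γ ∈ PSL₂(ℤ) that is simultaneously primitive, hyperbolic, reciprocal (conjugate in PSL₂(ℤ) to γ⁻¹), conjugate in PSL₂(ℤ) to an element ambiguous of the first kind, and conjugate in PSL₂(ℤ) to an element ambiguous of the second kind. -/

import Mathlib

open Matrix
open scoped MatrixGroups

instance : Fact (Even (Fintype.card (Fin 2))) := ⟨⟨1, rfl⟩⟩

/-- The determinant `-1` integer matrix `W = [[1, 0], [0, -1]]`. -/
noncomputable def Wmat : Matrix (Fin 2) (Fin 2) ℤ := !![1, 0; 0, -1]

/-- The determinant `-1` integer matrix `W₁ = [[1, 0], [1, -1]]`. -/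
noncomputable def W1mat : Matrix (Fin 2) (Fin 2) ℤ := !![1, 0; 1, -1]

/-- A lift `A ∈ SL₂(ℤ)` is ambiguous of the first kind if `W·A·W⁻¹ = ±A⁻¹`. -/
def Amb1 (A : SL(2, ℤ)) : Prop :=
  Wmat * (A : Matrix (Fin 2) (Fin 2) ℤ) * Wmat⁻¹ = ((A⁻¹ : SL(2, ℤ)) : Matrix (Fin 2) (Fin 2) ℤ) ∨
  Wmat * (A : Matrix (Fin 2) (Fin 2) ℤ) * Wmat⁻¹ = -((A⁻¹ : SL(2, ℤ)) : Matrix (Fin 2) (Fin 2) ℤ)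

/-- A lift `A ∈ SL₂(ℤ)` is ambiguous of the second kind if `W₁·A·W₁⁻¹ = ±A⁻¹`. -/
def Amb2 (A : SL(2, ℤ)) : Prop :=
  W1mat * (A : Matrix (Fin 2) (Fin 2) ℤ) * W1mat⁻¹ = ((A⁻¹ : SL(2, ℤ)) : Matrix (Fin 2) (Fin 2) ℤ) ∨
  W1mat * (A : Matrix (Fin 2) (Fin 2) ℤ) * W1mat⁻¹ = -((A⁻¹ : SL(2, ℤ)) : Matrix (Fin 2) (Fin 2) ℤ)

/-- The subgroup `{±1}` of `SL₂(ℤ)`. -/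
def pmOne : Subgroup SL(2, ℤ) := Subgroup.zpowers (-1)

instance : pmOne.Normal := by
  constructor
  intro x hx g
  obtain ⟨n, rfl⟩ := Subgroup.mem_zpowers_iff.mp hx
  have hc : Commute g (-1 : SL(2, ℤ)) := by
    show g * (-1) = (-1) * g
    apply Subtype.ext
    show ((g * (-1) : SL(2, ℤ)) : Matrix (Fin 2) (Fin 2) ℤ)
        = (((-1) * g : SL(2, ℤ)) : Matrix (Fin 2) (Fin 2) ℤ)
    simp
  have hcn : Commute g ((-1 : SL(2, ℤ)) ^ n) := hc.zpow_right n
  have : g * (-1 : SL(2, ℤ)) ^ n * g⁻¹ = (-1) ^ n := by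
    rw [hcn.eq, mul_assoc, mul_inv_cancel, mul_one]
  rw [this]
  exact Subgroup.zpow_mem _ (Subgroup.mem_zpowers _) n

/-- `PSL₂(ℤ) = SL₂(ℤ)/{±1}`. -/
abbrev PSL2Z := SL(2, ℤ) ⧸ pmOne

/-- An element of `PSL₂(ℤ)` is hyperbolic if the absolute value of the trace of a lift
to `SL₂(ℤ)` is greater than `2`. -/
def IsHyp (γ : PSL2Z) : Prop :=
  ∃ A : SL(2, ℤ), (QuotientGroup.mk A : PSL2Z) = γ ∧
    2 < |Matrix.trace (A : Matrix (Fin 2) (Fin 2) ℤ)|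

/-- An element of `PSL₂(ℤ)` is primitive if it is not a proper power. -/
def IsPrim (γ : PSL2Z) : Prop := ¬ ∃ (δ : PSL2Z) (n : ℕ), 2 ≤ n ∧ δ ^ n = γ

/-- An element of `PSL₂(ℤ)` is ambiguous of the first kind if it has a lift which is. -/
def AmbFst (γ : PSL2Z) : Prop :=
  ∃ A : SL(2, ℤ), (QuotientGroup.mk A : PSL2Z) = γ ∧ Amb1 A

/-- An element of `PSL₂(ℤ)` is ambiguous of the second kind if it has a lift which is. -/
def AmbSnd (γ : PSL2Z) : Prop :=
  ∃ A : SL(2, ℤ), (QuotientGroup.mk A : PSL2Z) = γ ∧ Amb2 A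

/-- The inverse hyperbolic cosine. -/
noncomputable def arcosh (x : ℝ) : ℝ := Real.log (x + Real.sqrt (x ^ 2 - 1))

/-- The translation length `ℓ(γ) = 2 arcosh(|tr γ|/2)` of `γ ∈ PSL₂(ℤ)` is at most `s`. -/
def TransLenLE (γ : PSL2Z) (s : ℝ) : Prop :=
  ∃ A : SL(2, ℤ), (QuotientGroup.mk A : PSL2Z) = γ ∧
    2 * arcosh (((|Matrix.trace (A : Matrix (Fin 2) (Fin 2) ℤ)| : ℤ) : ℝ) / 2) ≤ s

lemma mem_pmOne {x : SL(2, ℤ)} (hx : x ∈ pmOne) : x = 1 ∨ x = -1 := by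
  obtain ⟨n, rfl⟩ := Subgroup.mem_zpowers_iff.mp hx
  rcases Int.even_or_odd n with h | h
  · left; exact h.neg_one_zpow
  · right; exact h.neg_one_zpow

lemma neg_one_mem_pmOne : (-1 : SL(2, ℤ)) ∈ pmOne := Subgroup.mem_zpowers _

lemma mk_eq_iff (x y : SL(2, ℤ)) :
    (QuotientGroup.mk x : PSL2Z) = QuotientGroup.mk y ↔ x = y ∨ x = -y := by
  rw [QuotientGroup.eq]
  constructor
  · intro h
    rcases mem_pmOne h with h | h
    · left; exact (inv_mul_eq_one.mp h)
    · right
      have : y = x * (-1) := by rw [← h]; group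
      rw [this]; simp
  · rintro (rfl | rfl)
    · simp [pmOne.one_mem]
    · have : (-y)⁻¹ * y = -1 := by
        rw [inv_mul_eq_iff_eq_mul]; simp
      rw [this]; exact neg_one_mem_pmOne

/-- the entries of commuting matrices -/
lemma comm_entries {M A : Matrix (Fin 2) (Fin 2) ℤ} (h : M * A = A * M) :
    M 1 0 * A 0 1 = M 0 1 * A 1 0 ∧ M 1 0 * (A 0 0 - A 1 1) = A 1 0 * (M 0 0 - M 1 1) := by
  have h00 := congrFun (congrFun h 0) 0
  have h10 := congrFun (congrFun h 1) 0
  simp only [Matrix.mul_apply, Fin.sum_univ_two] at h00 h10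
  constructor <;> linarith

lemma sl_det (A : SL(2, ℤ)) : A 0 0 * A 1 1 - A 0 1 * A 1 0 = 1 := by
  have := A.det_coe
  rwa [Matrix.det_fin_two] at this

lemma tr_sq {A : SL(2, ℤ)} (hA : 2 < |Matrix.trace (A : Matrix (Fin 2) (Fin 2) ℤ)|) :
    4 < (A 0 0 + A 1 1) ^ 2 := by
  rw [Matrix.trace_fin_two] at hA
  have := sq_lt_sq' (by linarith) hA
  rw [sq_abs] at this
  linarith

lemma c_ne {A : SL(2, ℤ)} (hA : 4 < (A 0 0 + A 1 1) ^ 2) : A 1 0 ≠ 0 := by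
  intro h
  have hd := sl_det A
  rw [h] at hd
  have : A 0 0 * A 1 1 = 1 := by linarith
  rcases Int.mul_eq_one_iff_eq_one_or_neg_one.mp this with ⟨h1, h2⟩ | ⟨h1, h2⟩ <;>
    rw [h1, h2] at hA <;> norm_num at hA

/-- discriminant comparison -/
lemma disc_comm {M : Matrix (Fin 2) (Fin 2) ℤ} {A : SL(2, ℤ)} (h : M * A.1 = A.1 * M) :
    M 1 0 ^ 2 * ((A 0 0 + A 1 1) ^ 2 - 4) = A 1 0 ^ 2 * ((M 0 0 + M 1 1) ^ 2 - 4 * M.det) := by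
  obtain ⟨h1, h2⟩ := comm_entries h
  have hd := sl_det A
  rw [Matrix.det_fin_two]
  change M 1 0 * A 0 1 = M 0 1 * A 1 0 at h1
  change M 1 0 * (A 0 0 - A 1 1) = A 1 0 * (M 0 0 - M 1 1) at h2
  have e1 : (A 0 0 + A 1 1) ^ 2 - 4 = (A 0 0 - A 1 1) ^ 2 + 4 * (A 0 1 * A 1 0) := by
    linear_combination 4 * hd
  rw [e1]
  linear_combination (M 1 0 * (A 0 0 - A 1 1) + A 1 0 * (M 0 0 - M 1 1)) * h2
    + 4 * M 1 0 * A 1 0 * h1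

lemma not_square {t q : ℤ} (ht : 4 < t ^ 2) (h : t ^ 2 - 4 = q ^ 2) : False := by
  rw [← sq_abs t] at ht h
  rw [← sq_abs q] at h
  have hq := abs_nonneg q
  have h0 := abs_nonneg t
  generalize |t| = t at *
  generalize |q| = q at *
  have h1 : q < t := by nlinarith
  have h2 : 2 < t := by nlinarith
  rcases (show t = q + 1 ∨ q + 2 ≤ t by omega) with rfl | h3
  · have : 2 * q = 3 := by nlinarith
    omega
  · nlinarith

lemma neg_det_sq {M : Matrix (Fin 2) (Fin 2) ℤ} {A : SL(2, ℤ)} (hA : 4 < (A 0 0 + A 1 1) ^ 2)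
    (h : M * A.1 = A.1 * M) (hM : M.det = -1) : M * M ≠ 1 ∧ M * M ≠ -1 := by
  have hc := c_ne hA
  have hdisc := disc_comm h
  have hdet := hM
  rw [hM] at hdisc
  rw [Matrix.det_fin_two] at hdet
  constructor
  · intro hh
    have h00 := congrFun (congrFun hh 0) 0
    have h11 := congrFun (congrFun hh 1) 1
    simp [Matrix.mul_apply, Fin.sum_univ_two] at h00 h11
    have htr : (M 0 0 + M 1 1) ^ 2 = 0 := by linarith
    rw [htr] at hdisc
    have hdiv : M 1 0 ^ 2 ∣ (2 * A 1 0) ^ 2 := ⟨(A 0 0 + A 1 1) ^ 2 - 4, by linarith⟩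
    rw [Int.pow_dvd_pow_iff (by norm_num)] at hdiv
    obtain ⟨q, hq⟩ := hdiv
    have hm : M 1 0 ≠ 0 := by
      intro h0; rw [h0] at hq; apply hc; linarith
    refine not_square hA (q := q) ?_
    have : M 1 0 ^ 2 * ((A 0 0 + A 1 1) ^ 2 - 4) = M 1 0 ^ 2 * q ^ 2 := by
      rw [hdisc, ← mul_pow, ← hq]; ring
    exact mul_left_cancel₀ (pow_ne_zero 2 hm) this
  · intro hh
    have h00 := congrFun (congrFun hh 0) 0
    have h11 := congrFun (congrFun hh 1) 1
    simp [Matrix.mul_apply, Fin.sum_univ_two] at h00 h11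
    nlinarith [sq_nonneg (M 0 0 + M 1 1)]

/-- parabolic elements of the centralizer are trivial -/
lemma trivial_of_tr {A B : SL(2, ℤ)} (hA : 4 < (A 0 0 + A 1 1) ^ 2) (h : B * A = A * B)
    (hB : (B 0 0 + B 1 1) ^ 2 = 4) : B = 1 ∨ B = -1 := by
  have hc := c_ne hA
  have h' : B.1 * A.1 = A.1 * B.1 := congrArg Subtype.val h
  have hdisc := disc_comm h'
  have hdd : B.1.det = 1 := B.2
  rw [hdd] at hdisc
  change B 1 0 ^ 2 * ((A 0 0 + A 1 1) ^ 2 - 4) = A 1 0 ^ 2 * ((B 0 0 + B 1 1) ^ 2 - 4 * 1) at hdisc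
  rw [hB] at hdisc
  have h10 : B 1 0 = 0 := by
    have : B 1 0 ^ 2 * ((A 0 0 + A 1 1) ^ 2 - 4) = 0 := by rw [hdisc]; ring
    rcases mul_eq_zero.mp this with h | h
    · exact pow_eq_zero_iff (by norm_num) |>.mp h
    · linarith
  obtain ⟨h1, h2⟩ := comm_entries h'
  change B 1 0 * A 0 1 = B 0 1 * A 1 0 at h1
  change B 1 0 * (A 0 0 - A 1 1) = A 1 0 * (B 0 0 - B 1 1) at h2
  rw [h10] at h1 h2
  have h01 : B 0 1 = 0 := by
    have : B 0 1 * A 1 0 = 0 := by linarith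
    exact (mul_eq_zero.mp this).resolve_right hc
  have h00 : B 0 0 = B 1 1 := by
    have : A 1 0 * (B 0 0 - B 1 1) = 0 := by linarith
    linarith [(mul_eq_zero.mp this).resolve_left hc]
  have hs : B 1 1 ^ 2 = 1 := by rw [h00] at hB; linarith
  rcases sq_eq_sq_iff_eq_or_eq_neg.mp (hs.trans (one_pow 2).symm) with h | h
  · left
    ext i j
    fin_cases i <;> fin_cases j <;> simp [h10, h01, h00, h]
  · right
    ext i j
    fin_cases i <;> fin_cases j <;> simp [h10, h01, h00, h]

/-- automorphy factor -/
noncomputable def uu (z : ℝ) (B : SL(2, ℤ)) : ℝ := (B 1 0 : ℝ) * z + B 1 1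

lemma exists_z {A : SL(2, ℤ)} (hA : 4 < (A 0 0 + A 1 1) ^ 2) :
    ∃ z : ℝ, ∀ B : SL(2, ℤ), B * A = A * B → (B 0 0 : ℝ) * z + B 0 1 = uu z B * z := by
  have hc := c_ne hA
  have hcR : (A 1 0 : ℝ) ≠ 0 := by exact_mod_cast hc
  have hR : (4 : ℝ) < ((A 0 0 : ℝ) + A 1 1) ^ 2 := by exact_mod_cast hA
  have hd : (A 0 0 : ℝ) * A 1 1 - A 0 1 * A 1 0 = 1 := by exact_mod_cast sl_det A
  have hs := Real.sq_sqrt (show (0 : ℝ) ≤ ((A 0 0 : ℝ) + A 1 1) ^ 2 - 4 by linarith)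
  set s := Real.sqrt (((A 0 0 : ℝ) + A 1 1) ^ 2 - 4)
  obtain ⟨z, hz⟩ : ∃ z : ℝ, 2 * A 1 0 * z = (A 0 0 - A 1 1) + s :=
    ⟨((A 0 0 - A 1 1) + s) / (2 * A 1 0), by field_simp⟩
  have hq : (A 1 0 : ℝ) * z ^ 2 = (A 0 0 - A 1 1) * z + A 0 1 := by
    apply mul_left_cancel₀ hcR
    linear_combination (1 / 4) * (2 * A 1 0 * z - (A 0 0 - A 1 1) + s) * hz + (1 / 4) * hs + hd
  refine ⟨z, fun B hB => ?_⟩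
  obtain ⟨h1, h2⟩ := comm_entries (congrArg Subtype.val hB)
  have h1' : (B 1 0 : ℝ) * A 0 1 = B 0 1 * A 1 0 := by exact_mod_cast h1
  have h2' : (B 1 0 : ℝ) * (A 0 0 - A 1 1) = A 1 0 * (B 0 0 - B 1 1) := by exact_mod_cast h2
  unfold uu
  apply mul_left_cancel₀ hcR
  linear_combination -(B 1 0 : ℝ) * hq - h1' - z * h2'

lemma uu_mul {z : ℝ} {B C : SL(2, ℤ)} (hC : (C 0 0 : ℝ) * z + C 0 1 = uu z C * z) :
    uu z (B * C) = uu z B * uu z C := by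
  have e1 : (B * C) 1 0 = B 1 0 * C 0 0 + B 1 1 * C 1 0 := by
    simp [Matrix.mul_apply, Fin.sum_univ_two]
  have e2 : (B * C) 1 1 = B 1 0 * C 0 1 + B 1 1 * C 1 1 := by
    simp [Matrix.mul_apply, Fin.sum_univ_two]
  unfold uu at *
  rw [e1, e2]
  push_cast
  linear_combination (B 1 0 : ℝ) * hC

lemma uu_char {z : ℝ} {B : SL(2, ℤ)} (hB : (B 0 0 : ℝ) * z + B 0 1 = uu z B * z) :
    uu z B ^ 2 - (B 0 0 + B 1 1) * uu z B + 1 = 0 := by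
  have hd : (B 0 0 : ℝ) * B 1 1 - B 0 1 * B 1 0 = 1 := by exact_mod_cast sl_det B
  unfold uu at *
  linear_combination -(B 1 0 : ℝ) * hB - hd

lemma cent {A : SL(2, ℤ)} (hA : 4 < (A 0 0 + A 1 1) ^ 2)
    (hp : ∀ (B : SL(2, ℤ)) (n : ℕ), 2 ≤ n → B ^ n ≠ A ∧ B ^ n ≠ -A)
    (B : SL(2, ℤ)) (hB : B * A = A * B) : ∃ k : ℤ, B = A ^ k ∨ B = -A ^ k := by
  obtain ⟨z, hz⟩ := exists_z hA
  let H : Subgroup SL(2, ℤ) := Subgroup.centralizer {A}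
  have hH : ∀ B : SL(2, ℤ), B ∈ H ↔ B * A = A * B := by
    intro B
    simp only [H, Subgroup.mem_centralizer_singleton_iff]
    try exact eq_comm
  have hne : ∀ B : SL(2, ℤ), B ∈ H → uu z B ≠ 0 := by
    intro B hB h0
    have := uu_char (hz B ((hH B).mp hB))
    rw [h0] at this
    norm_num at this
  let f : Additive H →+ ℝ :=
    { toFun := fun x => Real.log (uu z (x.toMul : H).1)
      map_zero' := by simp [uu]
      map_add' := by
        intro x y
        have hx := (x.toMul : H).2
        have hy := (y.toMul : H).2
        have e := uu_mul (B := (x.toMul : H).1) (hz _ ((hH _).mp hy))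
        have := Real.log_mul (hne _ hx) (hne _ hy)
        rw [← e] at this
        exact this }
  have fdef : ∀ x : H, f (Additive.ofMul x) = Real.log (uu z x.1) := fun x => rfl
  -- kernel
  have hker : ∀ x : H, f (Additive.ofMul x) = 0 → x.1 = 1 ∨ x.1 = -1 := by
    intro x hx
    rw [fdef] at hx
    have hx2 := (hH _).mp x.2
    have hch := uu_char (hz _ hx2)
    apply trivial_of_tr hA hx2
    have hu : uu z x.1 = 1 ∨ uu z x.1 = -1 := by
      rcases Real.log_eq_zero.mp hx with h | h | h
      · exact absurd h (hne _ x.2)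
      · exact Or.inl h
      · exact Or.inr h
    have : ((x.1 0 0 : ℝ) + x.1 1 1) ^ 2 = 4 := by
      rcases hu with h | h <;> rw [h] at hch
      · have : (x.1 0 0 : ℝ) + x.1 1 1 = 2 := by linarith
        rw [this]; norm_num
      · have : (x.1 0 0 : ℝ) + x.1 1 1 = -2 := by linarith
        rw [this]; norm_num
    exact_mod_cast this
  have hiso : Disjoint (f.range : Set ℝ) (Set.Ioo 0 (Real.log 2)) := by
    rw [Set.disjoint_left]
    rintro _ ⟨x, rfl⟩ ⟨h1, h2⟩
    change 0 < Real.log (uu z (x.toMul : H).1) at h1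
    change Real.log (uu z (x.toMul : H).1) < Real.log 2 at h2
    have hx := (x.toMul : H).2
    generalize (x.toMul : H).1 = X at *
    have hch := uu_char (hz X ((hH X).mp hx))
    have hn := hne X hx
    generalize uu z X = u at *
    rw [← Real.log_abs] at h1 h2
    have hpos := abs_pos.mpr hn
    have h1' := (Real.log_pos_iff hpos.le).mp h1
    have h2' := (Real.log_lt_log_iff hpos (by norm_num)).mp h2
    have key : ((X 0 0 : ℝ) + X 1 1) ^ 2 * u ^ 2 = (u ^ 2 + 1) ^ 2 := by
      linear_combination -((X 0 0 + X 1 1) * u + (u ^ 2 + 1)) * hch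
    have hu1 : 1 < u ^ 2 := by rw [← sq_abs]; nlinarith
    have hu2 : u ^ 2 < 4 := by rw [← sq_abs]; nlinarith
    have k1 : 4 < ((X 0 0 : ℝ) + X 1 1) ^ 2 := by
      by_contra hcon
      push Not at hcon
      nlinarith [mul_le_mul_of_nonneg_right hcon (sq_nonneg u)]
    have k2 : ((X 0 0 : ℝ) + X 1 1) ^ 2 < 9 := by
      by_contra hcon
      push Not at hcon
      nlinarith [mul_le_mul_of_nonneg_right hcon (sq_nonneg u)]
    have k1' : 4 < (X 0 0 + X 1 1) ^ 2 := by exact_mod_cast k1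
    have k2' : (X 0 0 + X 1 1) ^ 2 < 9 := by exact_mod_cast k2
    generalize X 0 0 + X 1 1 = t at *
    have : t < 3 := by nlinarith
    have : -3 < t := by nlinarith
    interval_cases t <;> omega
  obtain ⟨b, hb⟩ := AddSubgroup.cyclic_of_isolated_zero (Real.log_pos (by norm_num)) hiso
  have hbmem : b ∈ f.range := by rw [hb]; exact AddSubgroup.mem_closure_singleton_self b
  obtain ⟨g, hg⟩ := hbmem
  let G : H := g.toMul
  have hgen : ∀ x : SL(2, ℤ), x * A = A * x → ∃ n : ℤ, x = G.1 ^ n ∨ x = -G.1 ^ n := by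
    intro x hx
    have hm : f (Additive.ofMul ⟨x, (hH x).mpr hx⟩) ∈ f.range := ⟨_, rfl⟩
    rw [hb, AddSubgroup.mem_closure_singleton] at hm
    obtain ⟨n, hn⟩ := hm
    rw [← hg, ← map_zsmul] at hn
    have h0 : f (Additive.ofMul (⟨x, (hH x).mpr hx⟩ * (G ^ n)⁻¹)) = 0 := by
      rw [ofMul_mul, ofMul_inv, map_add, map_neg, ← hn]
      exact add_neg_cancel _
    refine ⟨n, ?_⟩
    rcases hker _ h0 with h | h
    · left
      simp only [Subgroup.coe_mul, Subgroup.coe_inv, Subgroup.coe_zpow] at h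
      exact mul_inv_eq_one.mp h
    · right
      simp only [Subgroup.coe_mul, Subgroup.coe_inv, Subgroup.coe_zpow] at h
      rw [mul_inv_eq_iff_eq_mul] at h
      rw [h]; simp
  have hA1 : ∃ e : ℤ, (e = 1 ∨ e = -1) ∧ (A = G.1 ^ e ∨ A = -G.1 ^ e) := by
    obtain ⟨n, hn⟩ := hgen A rfl
    refine ⟨n, ?_, hn⟩
    by_contra hcon
    have hz0 : n ≠ 0 := by
      rintro rfl
      rcases hn with h | h <;> rw [h] at hA <;> norm_num at hA
    have h2 : 2 ≤ n.natAbs := by omega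
    have hcon2 : ∀ X : SL(2, ℤ), X ^ n.natAbs = G.1 ^ n → False := by
      intro X hX
      have := hp X _ h2
      rcases hn with h | h
      · exact this.1 (hX.trans h.symm)
      · apply this.2; rw [hX, h, neg_neg]
    rcases Int.natAbs_eq n with h | h
    · apply hcon2 G.1
      conv_rhs => rw [h]
      rw [zpow_natCast]
    · apply hcon2 G.1⁻¹
      conv_rhs => rw [h]
      rw [_root_.zpow_neg, zpow_natCast, inv_pow]
  obtain ⟨e, he, hAe⟩ := hA1
  obtain ⟨n, hn⟩ := hgen B hB
  have hpow : A ^ (e * n) = G.1 ^ n ∨ A ^ (e * n) = -G.1 ^ n := by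
    have hee : e * (e * n) = n := by rcases he with rfl | rfl <;> ring
    rcases hAe with h | h
    · left; rw [h, ← _root_.zpow_mul, hee]
    · have h' : A = (-1) * G.1 ^ e := by rw [h]; simp
      have hc : Commute (-1 : SL(2, ℤ)) (G.1 ^ e) := Commute.neg_one_left _
      rw [h', hc.mul_zpow, ← _root_.zpow_mul, hee]
      rcases Int.even_or_odd (e * n) with h | h
      · left; rw [h.neg_one_zpow, one_mul]
      · right; rw [h.neg_one_zpow]; simp
  refine ⟨e * n, ?_⟩
  rcases hpow with h | h <;> rw [h] <;> rcases hn with h | h <;> simp [h]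

/-- Reduction mod 2. -/
noncomputable def red : Matrix (Fin 2) (Fin 2) ℤ →+* Matrix (Fin 2) (Fin 2) (ZMod 2) :=
  (Int.castRingHom (ZMod 2)).mapMatrix

lemma red_neg (X : Matrix (Fin 2) (Fin 2) ℤ) : red (-X) = red X := by
  rw [map_neg]
  ext i j
  simp only [Matrix.neg_apply]
  exact ZMod.neg_eq_self_mod_two _

/-- Moving an inverter across inverse. -/
lemma inv_swap {A : SL(2, ℤ)} {V : Matrix (Fin 2) (Fin 2) ℤ} (h : V * A.1 = (A⁻¹).1 * V) :
    V * (A⁻¹).1 = A.1 * V := by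
  have e1 : A.1 * (A⁻¹).1 = 1 := congrArg Subtype.val (mul_inv_cancel A)
  calc V * (A⁻¹).1 = (A.1 * (A⁻¹).1) * V * (A⁻¹).1 := by rw [e1, one_mul]
    _ = A.1 * (V * A.1) * (A⁻¹).1 := by rw [h]; noncomm_ring
    _ = A.1 * V * (A.1 * (A⁻¹).1) := by noncomm_ring
    _ = A.1 * V := by rw [e1, mul_one]

lemma comm_of_inv {A : SL(2, ℤ)} {V V' : Matrix (Fin 2) (Fin 2) ℤ}
    (h : V * A.1 = (A⁻¹).1 * V) (h' : V' * A.1 = (A⁻¹).1 * V') :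
    (V * V') * A.1 = A.1 * (V * V') := by
  rw [mul_assoc, h', ← mul_assoc, inv_swap h, mul_assoc]

lemma sq_of_inv {A S : SL(2, ℤ)} (hA : 4 < (A 0 0 + A 1 1) ^ 2)
    (h : S.1 * A.1 = (A⁻¹).1 * S.1) : S.1 * S.1 = -1 := by
  have hc := c_ne hA
  have h10 := congrFun (congrFun h 1) 0
  rw [Matrix.SpecialLinearGroup.coe_inv, Matrix.adjugate_fin_two] at h10
  simp [Matrix.mul_apply, Fin.sum_univ_two] at h10
  have h0 : A 1 0 * (S 0 0 + S 1 1) = 0 := by linarith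
  have ht := (mul_eq_zero.mp h0).resolve_left hc
  have hd := sl_det S
  have hs : S 1 1 = - S 0 0 := by linarith
  rw [hs] at hd
  ext i j
  fin_cases i <;> fin_cases j <;> simp [Matrix.mul_apply, Fin.sum_univ_two, hs] <;> linarith

lemma core {A S : SL(2, ℤ)} {V V' : Matrix (Fin 2) (Fin 2) ℤ}
    (hA : 4 < (A 0 0 + A 1 1) ^ 2)
    (hp : ∀ (B : SL(2, ℤ)) (n : ℕ), 2 ≤ n → B ^ n ≠ A ∧ B ^ n ≠ -A)
    (hS : S.1 * A.1 = (A⁻¹).1 * S.1)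
    (hV : V * A.1 = (A⁻¹).1 * V) (hV' : V' * A.1 = (A⁻¹).1 * V')
    (dV : V.det = -1) (dV' : V'.det = -1) (rV : red V = 1) : red V' = 1 := by
  have hcen := cent hA hp
  have hSS := sq_of_inv hA hS
  let ψ : SL(2, ℤ) →* Matrix (Fin 2) (Fin 2) (ZMod 2) :=
    { toFun := fun X => red X.1
      map_one' := map_one red
      map_mul' := fun X Y => map_mul red X.1 Y.1 }
  have ψd : ∀ X : SL(2, ℤ), ψ X = red X.1 := fun _ => rfl
  have ψn : ∀ X : SL(2, ℤ), ψ (-X) = ψ X := fun X => by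
    rw [ψd, ψd, Matrix.SpecialLinearGroup.coe_neg, red_neg]
  have hA2 : ψ (A ^ (2 : ℤ)) = 1 := by
    have h := congrArg red hV
    rw [map_mul, map_mul, rV, mul_one, one_mul] at h
    change ψ A = ψ A⁻¹ at h
    rw [zpow_two, map_mul]
    nth_rewrite 2 [h]
    rw [← map_mul, mul_inv_cancel, map_one]
  have hAev : ∀ j : ℤ, ψ (A ^ (2 * j)) = 1 := by
    have : A ^ (2 : ℤ) ∈ ψ.ker := hA2
    intro j
    rw [_root_.zpow_mul]
    exact ψ.ker.zpow_mem this j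
  -- eta
  have hη := comm_of_inv hS hV
  have dη : (S.1 * V).det = -1 := by rw [Matrix.det_mul, dV, S.2]; norm_num
  let E : SL(2, ℤ) := ⟨(S.1 * V) * (S.1 * V), by rw [Matrix.det_mul, dη]; norm_num⟩
  have hE : E * A = A * E := by
    apply Subtype.ext
    change (S.1 * V) * (S.1 * V) * A.1 = A.1 * ((S.1 * V) * (S.1 * V))
    rw [mul_assoc, hη, ← mul_assoc, hη, mul_assoc]
  have ψE : ψ E = 1 := by
    change red ((S.1 * V) * (S.1 * V)) = 1
    simp only [map_mul, rV, mul_one]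
    rw [← map_mul, hSS, red_neg, map_one]
  have hA1 : ψ A = 1 := by
    obtain ⟨m, hm⟩ := hcen E hE
    have ψm : ψ (A ^ m) = 1 := by
      rcases hm with h | h
      · rw [← h, ψE]
      · rw [← ψn, ← h, ψE]
    rcases Int.even_or_odd' m with ⟨j, rfl | rfl⟩
    · exfalso
      have hcj : (S.1 * V) * (A ^ (-j)).1 = (A ^ (-j)).1 * (S.1 * V) := by
        have hcent : ∀ X ∈ Subgroup.zpowers A, (S.1 * V) * X.1 = X.1 * (S.1 * V) := by
          intro X hX
          rw [Subgroup.zpowers_eq_closure] at hX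
          induction hX using Subgroup.closure_induction with
          | mem x hx => rw [Set.mem_singleton_iff.mp hx]; exact hη
          | one => simp
          | mul x y _ _ hx hy =>
            change (S.1 * V) * (x.1 * y.1) = (x.1 * y.1) * (S.1 * V)
            rw [← mul_assoc, hx, mul_assoc, hy, mul_assoc]
          | inv x _ hx =>
            have e1 : x.1 * (x⁻¹).1 = 1 := congrArg Subtype.val (mul_inv_cancel x)
            have e2 : (x⁻¹).1 * x.1 = 1 := congrArg Subtype.val (inv_mul_cancel x)
            calc (S.1 * V) * (x⁻¹).1 = ((x⁻¹).1 * x.1) * (S.1 * V) * (x⁻¹).1 := by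
                  rw [e2, one_mul]
              _ = (x⁻¹).1 * ((S.1 * V) * x.1) * (x⁻¹).1 := by rw [hx, mul_assoc (x⁻¹).1 x.1]
              _ = (x⁻¹).1 * (S.1 * V) * (x.1 * (x⁻¹).1) := by noncomm_ring
              _ = _ := by rw [e1, mul_one]
        exact hcent _ (Subgroup.zpow_mem _ (Subgroup.mem_zpowers A) _)
      have hAj : (A ^ (-j)).1 * A.1 = A.1 * (A ^ (-j)).1 :=
        congrArg Subtype.val ((Commute.refl A).zpow_left (-j)).eq
      have hζ : ((S.1 * V) * (A ^ (-j)).1) * A.1 = A.1 * ((S.1 * V) * (A ^ (-j)).1) := by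
        rw [mul_assoc, hAj, ← mul_assoc, hη, mul_assoc]
      have dζ : ((S.1 * V) * (A ^ (-j)).1).det = -1 := by
        rw [Matrix.det_mul, dη, (A ^ (-j)).2]; norm_num
      obtain ⟨n1, n2⟩ := neg_det_sq hA hζ dζ
      have hsq : ((S.1 * V) * (A ^ (-j)).1) * ((S.1 * V) * (A ^ (-j)).1)
          = (E * A ^ (-(2 * j))).1 := by
        have e : A ^ (-(2 * j)) = A ^ (-j) * A ^ (-j) := by rw [← _root_.zpow_add]; congr 1; ring
        rw [e]
        change _ = (S.1 * V) * (S.1 * V) * ((A ^ (-j)).1 * (A ^ (-j)).1)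
        calc _ = (S.1 * V) * ((A ^ (-j)).1 * (S.1 * V)) * (A ^ (-j)).1 := by
              simp only [mul_assoc]
          _ = _ := by rw [← hcj]; simp only [mul_assoc]
      rw [hsq] at n1 n2
      rcases hm with h | h
      · apply n1; rw [h, ← _root_.zpow_add]; simp
      · apply n2; rw [h, neg_mul, ← _root_.zpow_add]; simp
    · rw [_root_.zpow_add, map_mul, hAev, one_mul, zpow_one] at ψm
      exact ψm
  let C : SL(2, ℤ) := ⟨V * V', by rw [Matrix.det_mul, dV, dV']; norm_num⟩
  have hC : C * A = A * C := Subtype.ext (comm_of_inv hV hV')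
  obtain ⟨k, hk⟩ := hcen C hC
  have hAk : ψ (A ^ k) = 1 := ψ.ker.zpow_mem (show A ∈ ψ.ker from hA1) k
  have hψC : ψ C = 1 := by
    rcases hk with h | h
    · rw [h, hAk]
    · rw [h, ψn, hAk]
  have : red (V * V') = 1 := hψC
  rwa [map_mul, rV, one_mul] at this

/-- Sign determination: an inverter up to sign is an honest inverter. -/
lemma sign_fix {A : SL(2, ℤ)} (hA : 4 < (A 0 0 + A 1 1) ^ 2) {V : Matrix (Fin 2) (Fin 2) ℤ}
    (hV2 : ∃ U, U * V = 1)
    (h : V * A.1 = (A⁻¹).1 * V ∨ V * A.1 = -((A⁻¹).1 * V)) : V * A.1 = (A⁻¹).1 * V := by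
  rcases h with h | h
  · exact h
  · exfalso
    obtain ⟨U, hU⟩ := hV2
    have hU' : V * U = 1 := mul_eq_one_comm.mp hU
    have h1 : A.1 = -(U * ((A⁻¹).1 * V)) := by
      rw [← mul_neg, ← h, ← mul_assoc, hU, one_mul]
    have h2 := congrArg Matrix.trace h1
    rw [Matrix.trace_neg, Matrix.trace_mul_comm, mul_assoc, hU', mul_one,
      Matrix.SpecialLinearGroup.coe_inv, Matrix.adjugate_fin_two, Matrix.trace_fin_two,
      Matrix.trace_fin_two] at h2
    simp at h2
    have h3 : A 0 0 + A 1 1 = 0 := by linarith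
    rw [h3] at hA
    norm_num at hA

/-- Transport of an ambiguous structure along conjugation. -/
lemma transport {A D g : SL(2, ℤ)} {X : Matrix (Fin 2) (Fin 2) ℤ}
    (hA : 4 < (A 0 0 + A 1 1) ^ 2) (hX : X * X = 1)
    (hg : g * A * g⁻¹ = D ∨ g * A * g⁻¹ = -D)
    (hD : X * D.1 * X⁻¹ = (D⁻¹).1 ∨ X * D.1 * X⁻¹ = -(D⁻¹).1) :
    ((g⁻¹).1 * X * g.1) * A.1 = (A⁻¹).1 * ((g⁻¹).1 * X * g.1) := by
  have e1 : g.1 * (g⁻¹).1 = 1 := congrArg Subtype.val (mul_inv_cancel g)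
  have e2 : (g⁻¹).1 * g.1 = 1 := congrArg Subtype.val (inv_mul_cancel g)
  have hXi : X⁻¹ = X := Matrix.inv_eq_left_inv hX
  rw [hXi] at hD
  -- replace `D` by the conjugate
  have hD' : X * (g * A * g⁻¹).1 * X = ((g * A * g⁻¹)⁻¹).1 ∨
      X * (g * A * g⁻¹).1 * X = -((g * A * g⁻¹)⁻¹).1 := by
    rcases hg with h | h
    · rw [h]; exact hD
    · have hi : (-D)⁻¹ = -D⁻¹ := by
        rw [inv_eq_iff_mul_eq_one]; simp
      rw [h, hi, Matrix.SpecialLinearGroup.coe_neg, Matrix.SpecialLinearGroup.coe_neg]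
      rw [mul_neg, neg_mul, neg_inj, neg_neg]
      rcases hD with h | h
      · exact Or.inl h
      · right; rw [h, neg_neg]
  have hinv : (g * A * g⁻¹)⁻¹ = g * A⁻¹ * g⁻¹ := by group
  rw [hinv] at hD'
  have key : ((g⁻¹).1 * X * g.1) * A.1 =
      (g⁻¹).1 * (X * (g * A * g⁻¹).1 * X) * g.1 * ((g⁻¹).1 * X * g.1) := by
    change _ = (g⁻¹).1 * (X * (g.1 * A.1 * (g⁻¹).1) * X) * g.1 * ((g⁻¹).1 * X * g.1)
    calc _ = (g⁻¹).1 * X * g.1 * A.1 * ((g⁻¹).1 * ((X * X) * g.1)) := by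
          rw [hX, one_mul, e2, mul_one]
      _ = (g⁻¹).1 * X * g.1 * A.1 * ((g⁻¹).1 * (X * ((g.1 * (g⁻¹).1) * (X * g.1)))) := by
          rw [e1, one_mul, mul_assoc X X]
      _ = _ := by simp only [mul_assoc]
  have key2 : (g⁻¹).1 * (g * A⁻¹ * g⁻¹).1 * g.1 = (A⁻¹).1 := by
    have : g⁻¹ * (g * A⁻¹ * g⁻¹) * g = A⁻¹ := by group
    exact congrArg Subtype.val this
  apply sign_fix hA
  · refine ⟨(g⁻¹).1 * X * g.1, ?_⟩
    calc _ = (g⁻¹).1 * X * (g.1 * (g⁻¹).1) * X * g.1 := by simp only [mul_assoc]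
      _ = (g⁻¹).1 * (X * X) * g.1 := by rw [e1, mul_one]; simp only [mul_assoc]
      _ = 1 := by rw [hX, mul_one, e2]
  · rcases hD' with h | h
    · left; rw [key, h, key2]
    · right; rw [key, h, mul_neg, neg_mul, key2, neg_mul]

lemma conj_lift {A D : SL(2, ℤ)} (h : IsConj (QuotientGroup.mk A : PSL2Z) (QuotientGroup.mk D)) :
    ∃ g : SL(2, ℤ), g * A * g⁻¹ = D ∨ g * A * g⁻¹ = -D := by
  obtain ⟨c, hc⟩ := isConj_iff.mp h
  obtain ⟨g, rfl⟩ := QuotientGroup.mk_surjective c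
  exact ⟨g, (mk_eq_iff _ _).mp hc⟩

/-- Lemma 15: no element of `PSL₂(ℤ)` is simultaneously primitive, hyperbolic,
reciprocal, conjugate to an element ambiguous of the first kind, and conjugate to an
element ambiguous of the second kind. -/
theorem no_reciprocal_ambiguous_of_both_kinds :
    ¬ ∃ γ : PSL2Z, IsPrim γ ∧ IsHyp γ ∧ IsConj γ γ⁻¹ ∧
      (∃ δ : PSL2Z, IsConj γ δ ∧ AmbFst δ) ∧
      (∃ δ : PSL2Z, IsConj γ δ ∧ AmbSnd δ) := by
  rintro ⟨γ, hprim, ⟨A, rfl, htr⟩, hrec, ⟨_, hc1, D, rfl, hD⟩, ⟨_, hc2, D', rfl, hD'⟩⟩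
  have hA := tr_sq htr
  have hp : ∀ (B : SL(2, ℤ)) (n : ℕ), 2 ≤ n → B ^ n ≠ A ∧ B ^ n ≠ -A := by
    intro B n hn
    constructor <;> intro h <;> apply hprim <;>
      refine ⟨QuotientGroup.mk B, n, hn, ?_⟩
    · exact (mk_eq_iff (B ^ n) A).mpr (Or.inl h)
    · exact (mk_eq_iff (B ^ n) A).mpr (Or.inr h)
  obtain ⟨S, hS⟩ := conj_lift (D := A⁻¹) hrec
  obtain ⟨g, hg⟩ := conj_lift hc1
  obtain ⟨g', hg'⟩ := conj_lift hc2
  have hSA : S.1 * A.1 = (A⁻¹).1 * S.1 := by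
    apply sign_fix hA
    · exact ⟨(S⁻¹).1, congrArg Subtype.val (inv_mul_cancel S)⟩
    · rcases hS with h | h
      · left
        have h2 : S * A = A⁻¹ * S := mul_inv_eq_iff_eq_mul.mp h
        exact congrArg Subtype.val h2
      · right
        have h2 : S * A = -A⁻¹ * S := mul_inv_eq_iff_eq_mul.mp h
        rw [neg_mul] at h2
        exact congrArg Subtype.val h2
  have hW : Wmat * Wmat = 1 := by
    ext i j; fin_cases i <;> fin_cases j <;> simp [Wmat]
  have hW1 : W1mat * W1mat = 1 := by
    ext i j; fin_cases i <;> fin_cases j <;> simp [W1mat]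
  have hV := transport hA hW hg hD
  have hV' := transport hA hW1 hg' hD'
  have rW : red Wmat = 1 := by
    ext i j; fin_cases i <;> fin_cases j <;> simp [red, Wmat]
  have hcon := core hA hp hSA hV hV'
    (by rw [Matrix.det_mul, Matrix.det_mul, (g⁻¹).2, g.2]; simp [Wmat, Matrix.det_fin_two])
    (by rw [Matrix.det_mul, Matrix.det_mul, (g'⁻¹).2, g'.2]; simp [W1mat, Matrix.det_fin_two])
    (by rw [map_mul, map_mul, rW, mul_one, ← map_mul,
          show (g⁻¹).1 * g.1 = 1 from congrArg Subtype.val (inv_mul_cancel g), map_one])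
  have e1 : g'.1 * (g'⁻¹).1 = 1 := congrArg Subtype.val (mul_inv_cancel g')
  have e3 : red g'.1 * red (g'⁻¹).1 = 1 := by rw [← map_mul, e1, map_one]
  have rW1 : red W1mat = 1 := by
    rw [map_mul, map_mul] at hcon
    calc red W1mat = (red g'.1 * red (g'⁻¹).1) * red W1mat * (red g'.1 * red (g'⁻¹).1) := by
          rw [e3, one_mul, mul_one]
      _ = red g'.1 * (red (g'⁻¹).1 * red W1mat * red g'.1) * red (g'⁻¹).1 := by
          simp only [mul_assoc]
      _ = 1 := by rw [hcon, mul_one, e3]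
  have := congrFun (congrFun rW1 1) 0
  simp [red, W1mat] at this
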